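/- Let A be a real m×n matrix, let k < p ≤ min(m, n), and let x_1, ..., x_p ∈ ℝ^m be an orthonormal set spanning a subspace X ⊆ ℝ^m. Let S := ((Aᵀ x_i)ᵀ (Aᵀ x_j))_{i,j=1}^p, let o_1, ..., o_k ∈ ℝ^p be orthonormal eigenvectors of S corresponding to its k largest eigenvalues λ_1 ≥ ... ≥ λ_k, and define x̃_j = ∑_{i=1}^p (o_j)_i x_i for j = 1, ..., k and C := ∑_{i=1}^k x̃_i (Aᵀ x̃_i)ᵀ. Then C is a best approximation of A among matrices of rank at most k whose columns lie in X: for every m×n real matrix B with rank B ≤ k and every column of B belonging to X, ‖A − C‖_F ≤ ‖A − B‖_F. -/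

import Mathlib

open Matrix BigOperators

/-- The Frobenius norm of a real matrix: `‖M‖_F = √(trace (Mᵀ M))`. -/
noncomputable def frobNorm {m n : ℕ} (M : Matrix (Fin m) (Fin n) ℝ) : ℝ :=
  Real.sqrt (Matrix.trace (Mᵀ * M))

theorem trace_transpose_mul_self_nonneg {m n : ℕ} (M : Matrix (Fin m) (Fin n) ℝ) :
    0 ≤ trace (Mᵀ * M) := by
  simp only [trace, diag_apply, mul_apply, transpose_apply]
  exact Finset.sum_nonneg fun _ _ => Finset.sum_nonneg fun _ _ => mul_self_nonneg _

/-- The matrix of the orthogonal projection onto a subspace of Euclidean space. -/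
theorem exists_projection_onto_submodule {p n : ℕ} (V : Submodule ℝ (EuclideanSpace ℝ (Fin p)))
    (E : Matrix (Fin p) (Fin n) ℝ) (hE : ∀ j, WithLp.toLp 2 (fun a => E a j) ∈ V) :
    ∃ Q : Matrix (Fin p) (Fin p) ℝ,
      Qᵀ = Q ∧ Q * Q = Q ∧ Q * E = E ∧ trace Q = Module.finrank ℝ V := by
  let b := stdOrthonormalBasis ℝ V
  let U : Matrix (Fin p) (Fin (Module.finrank ℝ V)) ℝ :=
    Matrix.of fun i j => (b j : EuclideanSpace ℝ (Fin p)) i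
  have hU : Uᵀ * U = 1 := by
    ext i j
    have h := orthonormal_iff_ite.mp b.orthonormal i j
    rw [Submodule.coe_inner, PiLp.inner_apply] at h
    rw [one_apply, ← h, mul_apply]
    exact Finset.sum_congr rfl fun a _ => mul_comm _ _
  have hUE : U * Uᵀ * E = E := by
    ext i j
    have h := congrArg (fun w : V => (w : EuclideanSpace ℝ (Fin p)) i) (b.sum_repr' ⟨_, hE j⟩)
    simp only [Submodule.coe_sum, Submodule.coe_smul, Submodule.coe_inner, PiLp.inner_apply,
      WithLp.ofLp_sum, Finset.sum_apply, PiLp.smul_apply, smul_eq_mul] at h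
    rw [← h, Matrix.mul_assoc, mul_apply]
    refine Finset.sum_congr rfl fun c _ => ?_
    rw [mul_comm, mul_apply]
    congr 1
    exact Finset.sum_congr rfl fun a _ => mul_comm _ _
  refine ⟨U * Uᵀ, by simp, ?_, hUE, ?_⟩
  · rw [Matrix.mul_assoc, ← Matrix.mul_assoc Uᵀ, hU, Matrix.one_mul]
  · rw [trace_mul_comm, hU, trace_one, Fintype.card_fin]

/-- The matrix of the orthogonal projection onto the column space of a real matrix. -/
theorem exists_projection_onto_columns {p n : ℕ} (E : Matrix (Fin p) (Fin n) ℝ) :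
    ∃ Q : Matrix (Fin p) (Fin p) ℝ, Qᵀ = Q ∧ Q * Q = Q ∧ Q * E = E ∧ trace Q = E.rank := by
  rw [Matrix.rank_eq_finrank_range_toLin E (EuclideanSpace.basisFun (Fin p) ℝ).toBasis
    (EuclideanSpace.basisFun (Fin n) ℝ).toBasis, ← Matrix.toEuclideanLin_eq_toLin_orthonormal]
  refine exists_projection_onto_submodule _ E fun j => ⟨EuclideanSpace.single j 1, ?_⟩
  ext a
  simp [Matrix.toLpLin_apply]

theorem trace_sub_projection_mul {p n : ℕ} (G : Matrix (Fin p) (Fin n) ℝ)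
    {Q : Matrix (Fin p) (Fin p) ℝ} (hQ : Qᵀ = Q) (hQQ : Q * Q = Q) :
    trace ((G - Q * G)ᵀ * (G - Q * G)) = trace (G * Gᵀ) - trace (Q * (G * Gᵀ)) := by
  have h : (G - Q * G)ᵀ * (G - Q * G) = Gᵀ * G - Gᵀ * (Q * G) := by
    have hQG : Q * (Q * G) = Q * G := by rw [← Matrix.mul_assoc, hQQ]
    simp only [transpose_sub, transpose_mul, hQ, Matrix.sub_mul, Matrix.mul_sub,
      Matrix.mul_assoc, hQG]
    abel
  rw [h, trace_sub, trace_mul_comm Gᵀ G, trace_mul_comm Gᵀ, Matrix.mul_assoc]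

theorem trace_sub_projection_mul_le {p n : ℕ} (G E : Matrix (Fin p) (Fin n) ℝ)
    {Q : Matrix (Fin p) (Fin p) ℝ} (hQ : Qᵀ = Q) (hQQ : Q * Q = Q) (hE : Q * E = E) :
    trace ((G - Q * G)ᵀ * (G - Q * G)) ≤ trace ((G - E)ᵀ * (G - E)) := by
  have h : (G - E)ᵀ * (G - E) =
      (G - Q * G)ᵀ * (G - Q * G) + (Q * (G - E))ᵀ * (Q * (G - E)) := by
    have hQG : Q * (Q * G) = Q * G := by rw [← Matrix.mul_assoc, hQQ]
    have hEQ : ∀ M : Matrix (Fin p) (Fin n) ℝ, Eᵀ * (Q * M) = Eᵀ * M := by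
      intro M
      rw [← Matrix.mul_assoc]
      congr 1
      simpa [hQ] using congrArg transpose hE
    simp only [transpose_sub, transpose_mul, hQ, Matrix.sub_mul, Matrix.mul_sub,
      Matrix.mul_assoc, hQG, hE, hEQ]
    abel
  rw [h, trace_add]
  linarith [trace_transpose_mul_self_nonneg (Q * (G - E))]

theorem transpose_sub_mul_self_of_isometry {m n p : ℕ} (A : Matrix (Fin m) (Fin n) ℝ)
    {Y : Matrix (Fin m) (Fin p) ℝ} (hY : Yᵀ * Y = 1) (E : Matrix (Fin p) (Fin n) ℝ) :
    (A - Y * E)ᵀ * (A - Y * E) =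
      Aᵀ * A - (Yᵀ * A)ᵀ * (Yᵀ * A) + (Yᵀ * A - E)ᵀ * (Yᵀ * A - E) := by
  have h : Yᵀ * (Y * E) = E := by rw [← Matrix.mul_assoc, hY, Matrix.one_mul]
  simp only [transpose_sub, transpose_mul, transpose_transpose, Matrix.sub_mul, Matrix.mul_sub,
    Matrix.mul_assoc, h]
  abel

theorem sum_ite_lt_eq_sum_castLE {k p : ℕ} (hkp : k ≤ p) (f : Fin p → ℝ) :
    ∑ i : Fin p, (if i.val < k then f i else 0) = ∑ j : Fin k, f (Fin.castLE hkp j) := by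
  obtain ⟨q, rfl⟩ := Nat.exists_eq_add_of_le hkp
  rw [Fin.sum_univ_add]
  simp
  rfl

theorem sum_mul_le_sum_ite_lt {k p : ℕ} (hkp : k < p) {lam w : Fin p → ℝ}
    (hlam : Antitone lam) (hlam0 : ∀ i, 0 ≤ lam i) (hw0 : ∀ i, 0 ≤ w i) (hw1 : ∀ i, w i ≤ 1)
    (hw : ∑ i, w i ≤ k) :
    ∑ i, w i * lam i ≤ ∑ i : Fin p, (if i.val < k then (1 : ℝ) else 0) * lam i := by
  have hterm : ∀ i : Fin p, w i * lam i ≤ (if i.val < k then (1 : ℝ) else 0) * lam i +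
      (w i - if i.val < k then (1 : ℝ) else 0) * lam ⟨k, hkp⟩ := by
    intro i
    split_ifs with hi
    · have : lam ⟨k, hkp⟩ ≤ lam i := hlam (Fin.le_def.mpr hi.le)
      nlinarith [hw1 i]
    · have : lam i ≤ lam ⟨k, hkp⟩ := hlam (Fin.le_def.mpr (not_lt.mp hi))
      nlinarith [hw0 i]
  have hcard : ∑ i : Fin p, (if i.val < k then (1 : ℝ) else 0) = k := by
    rw [sum_ite_lt_eq_sum_castLE hkp.le]
    simp
  have hsum := Finset.sum_le_sum fun i (_ : i ∈ Finset.univ) => hterm i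
  rw [Finset.sum_add_distrib, ← Finset.sum_mul, Finset.sum_sub_distrib, hcard] at hsum
  nlinarith [hlam0 ⟨k, hkp⟩]

theorem diag_projection_mem_Icc {p : ℕ} {Q : Matrix (Fin p) (Fin p) ℝ}
    (hQ : Qᵀ = Q) (hQQ : Q * Q = Q) (i : Fin p) : Q i i ∈ Set.Icc (0 : ℝ) 1 := by
  have hsymm : ∀ a b, Q a b = Q b a := fun a b => congrFun (congrFun hQ b) a
  have h : ∑ j, Q i j * Q i j = Q i i := by
    conv_rhs => rw [← hQQ, mul_apply]
    exact Finset.sum_congr rfl fun j _ => by rw [hsymm j i]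
  have h1 : Q i i * Q i i ≤ Q i i := by
    conv_rhs => rw [← h]
    exact Finset.single_le_sum (f := fun j => Q i j * Q i j)
      (fun j _ => mul_self_nonneg _) (Finset.mem_univ i)
  constructor <;> nlinarith [mul_self_nonneg (Q i i)]

/-- Truncating a matrix with orthogonal rows of decreasing norm to its first `k` rows gives a best
approximation of rank at most `k`. -/
theorem trace_sub_truncation_le {p n k : ℕ} (hkp : k < p) {lam : Fin p → ℝ} (hlam : Antitone lam)
    {G : Matrix (Fin p) (Fin n) ℝ} (hG : G * Gᵀ = diagonal lam)
    {E : Matrix (Fin p) (Fin n) ℝ} (hE : E.rank ≤ k) {P : Matrix (Fin p) (Fin p) ℝ}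
    (hP : P = diagonal fun i => if i.val < k then 1 else 0) :
    trace ((G - P * G)ᵀ * (G - P * G)) ≤ trace ((G - E)ᵀ * (G - E)) := by
  obtain ⟨Q, hQ, hQQ, hQE, htr⟩ := exists_projection_onto_columns E
  have hPt : Pᵀ = P := by rw [hP, diagonal_transpose]
  have hPP : P * P = P := by simp [hP, diagonal_mul_diagonal]
  have hlam0 : ∀ i, 0 ≤ lam i := by
    intro i
    have h := congrFun (congrFun hG i) i
    rw [diagonal_apply_eq, mul_apply] at h
    rw [← h]
    exact Finset.sum_nonneg fun j _ => mul_self_nonneg (G i j)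
  refine le_trans ?_ (trace_sub_projection_mul_le G E hQ hQQ hQE)
  rw [trace_sub_projection_mul G hPt hPP, trace_sub_projection_mul G hQ hQQ, hG]
  have hw : ∑ i, Q i i ≤ k := by
    have : trace Q ≤ k := by rw [htr]; exact_mod_cast hE
    simpa [trace] using this
  have h := sum_mul_le_sum_ite_lt hkp hlam hlam0 (fun i => (diag_projection_mem_Icc hQ hQQ i).1)
    (fun i => (diag_projection_mem_Icc hQ hQQ i).2) hw
  have hQtr : trace (Q * diagonal lam) = ∑ i, Q i i * lam i := by
    simp [trace, mul_diagonal]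
  have hPtr : trace (P * diagonal lam) =
      ∑ i : Fin p, (if i.val < k then (1 : ℝ) else 0) * lam i := by
    rw [hP, diagonal_mul_diagonal, trace_diagonal]
  rw [hQtr, hPtr]
  linarith

/-- Best approximation with columns in a subspace: with `x 1, ..., x p` an orthonormal
set spanning `X ⊆ ℝ^m` (`k < p ≤ min m n`), `S = ((Aᵀ xᵢ)ᵀ (Aᵀ xⱼ))ᵢⱼ` its Gram matrix,
eigenvalues `λ 0 ≥ ... ≥ λ (p-1)` of `S` with orthonormal eigenvectors `o i`,
`x̃ j = ∑ᵢ (o j)ᵢ • x i` (`j < k`) and `C = ∑_{i<k} x̃ᵢ (Aᵀ x̃ᵢ)ᵀ`, for every `B` of rank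
at most `k` all of whose columns lie in `X` one has `‖A − C‖_F ≤ ‖A − B‖_F`. -/
theorem update_best_in_subspace (m n p k : ℕ) (hkp : k < p) (hp : p ≤ min m n)
    (A : Matrix (Fin m) (Fin n) ℝ)
    (x : Fin p → Fin m → ℝ)
    (hx : ∀ i j, x i ⬝ᵥ x j = if i = j then (1 : ℝ) else 0)
    (S : Matrix (Fin p) (Fin p) ℝ)
    (hS : S = Matrix.of fun i j => (Aᵀ.mulVec (x i)) ⬝ᵥ (Aᵀ.mulVec (x j)))
    (lam : Fin p → ℝ) (hlam : Antitone lam)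
    (o : Fin p → Fin p → ℝ)
    (ho : ∀ i j, o i ⬝ᵥ o j = if i = j then (1 : ℝ) else 0)
    (hoeig : ∀ i, S.mulVec (o i) = lam i • o i)
    (xt : Fin k → Fin m → ℝ)
    (hxt : ∀ j : Fin k, xt j = ∑ i : Fin p, o (Fin.castLE hkp.le j) i • x i)
    (C : Matrix (Fin m) (Fin n) ℝ)
    (hC : C = ∑ i : Fin k, vecMulVec (xt i) (Aᵀ.mulVec (xt i))) :
    ∀ B : Matrix (Fin m) (Fin n) ℝ, B.rank ≤ k →
      (∀ j : Fin n, (fun i => B i j) ∈ Submodule.span ℝ (Set.range x)) →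
      frobNorm (A - C) ≤ frobNorm (A - B) := by
  intro B hrank hcol
  let X : Matrix (Fin m) (Fin p) ℝ := Matrix.of fun a i => x i a
  let O : Matrix (Fin p) (Fin p) ℝ := Matrix.of fun i j => o i j
  let P : Matrix (Fin p) (Fin p) ℝ := diagonal fun i => if i.val < k then 1 else 0
  let Y := X * Oᵀ
  have hX : Xᵀ * X = 1 := by
    ext i j
    exact (hx i j).trans (one_apply (i := i) (j := j)).symm
  have hO : O * Oᵀ = 1 := by
    ext i j
    exact (ho i j).trans (one_apply (i := i) (j := j)).symm
  have hO' : Oᵀ * O = 1 := mul_eq_one_comm.mp hO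
  have hY : Yᵀ * Y = 1 := by
    rw [show Yᵀ * Y = O * (Xᵀ * X) * Oᵀ by simp [Y, Matrix.mul_assoc], hX, Matrix.mul_one, hO]
  have hYY : Y * Yᵀ = X * Xᵀ := by
    rw [show Y * Yᵀ = X * (Oᵀ * O) * Xᵀ by simp [Y, Matrix.mul_assoc], hO', Matrix.mul_one]
  have hS' : S = Xᵀ * A * (Xᵀ * A)ᵀ := by
    rw [hS]
    ext i j
    simp only [of_apply, mul_apply, transpose_apply, dotProduct, mulVec, X]
    simp only [mul_comm]
  have hSO : S * Oᵀ = Oᵀ * diagonal lam := by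
    ext i j
    rw [mul_diagonal]
    have h := congrFun (hoeig j) i
    rw [Pi.smul_apply, smul_eq_mul, mul_comm] at h
    exact h
  have hG : Yᵀ * A * (Yᵀ * A)ᵀ = diagonal lam := by
    rw [show Yᵀ * A * (Yᵀ * A)ᵀ = O * ((Xᵀ * A * (Xᵀ * A)ᵀ) * Oᵀ) by
      simp [Y, Matrix.mul_assoc], ← hS', hSO, ← Matrix.mul_assoc, hO, Matrix.one_mul]
  have hB : B = Y * (Yᵀ * B) := by
    have hfix : ∀ v ∈ Submodule.span ℝ (Set.range x), (X * Xᵀ) *ᵥ v = v := by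
      intro v hv
      have hle : Submodule.span ℝ (Set.range x) ≤
          LinearMap.eqLocus (X * Xᵀ).mulVecLin LinearMap.id := by
        rw [Submodule.span_le]
        rintro _ ⟨i, rfl⟩
        have h : X * Xᵀ * X = X := by rw [Matrix.mul_assoc, hX, Matrix.mul_one]
        ext a
        exact congrFun (congrFun h a) i
      exact hle hv
    rw [← Matrix.mul_assoc, hYY]
    ext a j
    exact (congrFun (hfix _ (hcol j)) a).symm
  have hC' : C = Y * (P * (Yᵀ * A)) := by
    have hxtY : ∀ j a, xt j a = Y a (Fin.castLE hkp.le j) := by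
      intro j a
      rw [hxt, Finset.sum_apply]
      simp [Y, X, O, mul_apply, mul_comm]
    rw [hC]
    ext a b
    rw [Matrix.sum_apply, mul_apply]
    have h := sum_ite_lt_eq_sum_castLE hkp.le fun i => Y a i * (Yᵀ * A) i b
    simp only [P, diagonal_mul, ite_mul, one_mul, zero_mul, mul_ite, mul_zero]
    rw [h]
    refine Finset.sum_congr rfl fun j _ => ?_
    simp only [vecMulVec_apply, mulVec, dotProduct, hxtY, mul_apply, transpose_apply]
    simp only [mul_comm]
  have hE : (Yᵀ * B).rank ≤ k := (rank_mul_le_right _ _).trans hrank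
  refine Real.sqrt_le_sqrt ?_
  rw [hB, hC', transpose_sub_mul_self_of_isometry A hY, transpose_sub_mul_self_of_isometry A hY,
    trace_add, trace_add]
  exact add_le_add le_rfl (trace_sub_truncation_le hkp hlam hG hE rfl)
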